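/- Fix β > 0 and let F : ℕ → [0,∞) satisfy F(N)/N → F₀ as N → ∞ for some constant 0 ≤ F₀ < 4β. For each N ≥ 2 let λ(N) be the unique real number with Σ_{k=1}^N m(λ(N) + k·F(N)) = 1, and set σ_N² = Σ_{k=1}^N v(λ(N) + k·F(N)). Then there exists a constant C = C(β,F₀) > 0 such that N²·σ_N² → C as N → ∞; moreover there is a constant C' > 0 such that v(λ(N) + k·F(N)) ≤ C'·N^{−3} for all 1 ≤ k ≤ N and all large N. -/

import Mathlib

open MeasureTheory Filter

noncomputable section

/-- Normalizing constant `c(λ) = ∫₀¹ e^{−λx − β/x} dx`. -/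
def cpart (β l : ℝ) : ℝ := ∫ x in (0:ℝ)..1, Real.exp (-(l * x) - β / x)

/-- Single-particle mean `m(λ)`. -/
def mpart (β l : ℝ) : ℝ :=
  (∫ x in (0:ℝ)..1, x * Real.exp (-(l * x) - β / x)) / cpart β l

/-- Single-particle variance `v(λ)`. -/
def vpart (β l : ℝ) : ℝ :=
  (∫ x in (0:ℝ)..1, x ^ 2 * Real.exp (-(l * x) - β / x)) / cpart β l - mpart β l ^ 2

lemma intg (β l : ℝ) (hβ : 0 < β) (g : ℝ → ℝ) (hg : Continuous g) :
    IntervalIntegrable (fun x => g x * Real.exp (-(l * x) - β / x)) volume 0 1 := by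
  have h1 : IntervalIntegrable (fun x => Real.exp (-(l * x) - β / x)) volume 0 1 := by
    have h2 : IntervalIntegrable (fun x => Real.exp (-(l * x))) volume 0 1 :=
      (by fun_prop : Continuous fun x : ℝ => Real.exp (-(l * x))).intervalIntegrable _ _
    refine h2.mono_fun (by fun_prop) ?_
    rw [Set.uIoc_of_le zero_le_one]
    filter_upwards [ae_restrict_mem measurableSet_Ioc] with x hx
    rw [Real.norm_eq_abs, Real.norm_eq_abs, abs_of_pos (Real.exp_pos _), abs_of_pos (Real.exp_pos _)]
    apply Real.exp_le_exp.2
    have := div_pos hβ hx.1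
    linarith
  exact h1.continuousOn_mul hg.continuousOn

lemma cpart_pos (β l : ℝ) (hβ : 0 < β) : 0 < cpart β l := by
  unfold cpart
  apply intervalIntegral.intervalIntegral_pos_of_pos_on _ _ zero_lt_one
  · simpa using intg β l hβ (fun _ => 1) continuous_const
  · intro x _; exact Real.exp_pos _

lemma mpart_antitone (β : ℝ) (hβ : 0 < β) : Antitone (mpart β) := by
  intro l l' hl
  set m := mpart β l with hm
  have hc := cpart_pos β l hβ
  have hc' := cpart_pos β l' hβ
  have e0 : ∫ x in (0:ℝ)..1, (x - m) * Real.exp (-(l * x) - β / x) = 0 := by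
    have h1 := intg β l hβ (fun x => x) continuous_id
    have h2 := intg β l hβ (fun _ => m) continuous_const
    simp_rw [sub_mul]
    rw [intervalIntegral.integral_sub h1 h2, intervalIntegral.integral_const_mul]
    have : m * cpart β l = ∫ x in (0:ℝ)..1, x * Real.exp (-(l * x) - β / x) := by
      rw [hm]; unfold mpart; exact div_mul_cancel₀ _ hc.ne'
    unfold cpart at this
    linarith
  have e1 : ∫ x in (0:ℝ)..1, (x - m) * Real.exp (-(l' * x) - β / x) =
      (∫ x in (0:ℝ)..1, x * Real.exp (-(l' * x) - β / x)) - m * cpart β l' := by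
    have h1 := intg β l' hβ (fun x => x) continuous_id
    have h2 := intg β l' hβ (fun _ => m) continuous_const
    simp_rw [sub_mul]
    rw [intervalIntegral.integral_sub h1 h2, intervalIntegral.integral_const_mul]
    rfl
  have e2 : ∫ x in (0:ℝ)..1, (x - m) * Real.exp (-(l' * x) - β / x) ≤
      ∫ x in (0:ℝ)..1, Real.exp (-((l' - l) * m)) * ((x - m) * Real.exp (-(l * x) - β / x)) := by
    apply intervalIntegral.integral_mono_on zero_le_one
    · exact intg β l' hβ (fun x => x - m) (by fun_prop)
    · exact (intg β l hβ (fun x => x - m) (by fun_prop)).const_mul _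
    · intro x _
      have : Real.exp (-(l' * x) - β / x) =
        Real.exp (-((l' - l) * x)) * Real.exp (-(l * x) - β / x) := by
        rw [← Real.exp_add]; congr 1; ring
      rw [this]
      have h3 : (x - m) * Real.exp (-((l' - l) * x)) ≤ (x - m) * Real.exp (-((l' - l) * m)) := by
        rcases le_total x m with h | h
        · apply mul_le_mul_of_nonpos_left _ (by linarith)
          apply Real.exp_le_exp.2
          nlinarith
        · apply mul_le_mul_of_nonneg_left _ (by linarith)
          apply Real.exp_le_exp.2
          nlinarith
      have := mul_le_mul_of_nonneg_right h3 (Real.exp_pos (-(l * x) - β / x)).le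
      linarith
  rw [intervalIntegral.integral_const_mul, e0, mul_zero, e1] at e2
  unfold mpart
  rw [div_le_iff₀ hc']
  linarith

/-- rescaled moments -/
def Jm (β : ℝ) (k : ℕ) (r : ℝ) : ℝ :=
  ∫ z in (-r)..(r ^ 3 / β - r), z ^ k * Real.exp (-(z ^ 2 / (1 + z / r)))

lemma dom_bound (k : ℕ) (r z : ℝ) (hr : 1 ≤ r) (hz : -r < z) :
    |z ^ k * Real.exp (-(z ^ 2 / (1 + z / r)))| ≤
      (Real.exp 1 * (k.factorial + (k + 2).factorial)) * (1 + z ^ 2)⁻¹ := by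
  have hr0 : 0 < r := by linarith
  have hden : 0 < 1 + z / r := by
    have : -1 < z / r := by rw [lt_div_iff₀ hr0]; linarith
    linarith
  have hle : 1 + z / r ≤ 1 + |z| := by
    have h1 : z / r ≤ |z| / r := by gcongr; exact le_abs_self z
    have h2 : |z| / r ≤ |z| := div_le_self (abs_nonneg _) hr
    linarith
  have h1 : |z| - 1 ≤ z ^ 2 / (1 + z / r) := by
    rw [le_div_iff₀ hden]
    rw [← sq_abs z]
    rcases le_total (|z|) 1 with h | h
    · nlinarith [sq_nonneg (|z|)]
    · nlinarith
  have h2 : Real.exp (-(z ^ 2 / (1 + z / r))) ≤ Real.exp 1 * Real.exp (-|z|) := by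
    rw [← Real.exp_add]; apply Real.exp_le_exp.2; linarith
  have h3 := Real.pow_div_factorial_le_exp (|z|) (abs_nonneg z) k
  have h4 := Real.pow_div_factorial_le_exp (|z|) (abs_nonneg z) (k + 2)
  rw [div_le_iff₀ (by positivity)] at h3 h4
  rw [abs_mul, abs_pow, abs_of_pos (Real.exp_pos _), ← div_eq_mul_inv, le_div_iff₀ (by positivity)]
  have h5 : |z| ^ k * (1 + z ^ 2) ≤ Real.exp |z| * (k.factorial + (k + 2).factorial) := by
    have : |z| ^ k * (1 + z ^ 2) = |z| ^ k + |z| ^ (k + 2) := by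
      rw [← sq_abs z]; ring
    rw [this]; linarith
  calc |z| ^ k * Real.exp (-(z ^ 2 / (1 + z / r))) * (1 + z ^ 2)
      = (|z| ^ k * (1 + z ^ 2)) * Real.exp (-(z ^ 2 / (1 + z / r))) := by ring
    _ ≤ (Real.exp |z| * (k.factorial + (k + 2).factorial)) * (Real.exp 1 * Real.exp (-|z|)) := by
        gcongr
    _ = (Real.exp |z| * Real.exp (-|z|)) * (Real.exp 1 * (k.factorial + (k + 2).factorial)) := by ring
    _ = _ := by rw [← Real.exp_add]; simp

lemma Jm_intg (β : ℝ) (hβ : 0 < β) (k : ℕ) (r : ℝ) (hr : 1 ≤ r) :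
    IntervalIntegrable (fun z => z ^ k * Real.exp (-(z ^ 2 / (1 + z / r)))) volume
      (-r) (r ^ 3 / β - r) := by
  have hle : -r ≤ r ^ 3 / β - r := by
    have : 0 ≤ r ^ 3 / β := by positivity
    linarith
  rw [intervalIntegrable_iff_integrableOn_Ioc_of_le hle]
  refine Integrable.mono' (g := fun z => (Real.exp 1 * (k.factorial + (k + 2).factorial)) * (1 + z ^ 2)⁻¹)
    (integrable_inv_one_add_sq.const_mul _).integrableOn (by fun_prop) ?_
  filter_upwards [ae_restrict_mem measurableSet_Ioc] with z hz
  exact dom_bound k r z hr hz.1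

lemma Jm_tendsto (β : ℝ) (hβ : 0 < β) (k : ℕ) :
    Tendsto (Jm β k) atTop (nhds (∫ z : ℝ, z ^ k * Real.exp (-(z ^ 2)))) := by
  have key : Tendsto (fun r : ℝ => ∫ z : ℝ, (Set.Ioc (-r) (r ^ 3 / β - r)).indicator
      (fun z => z ^ k * Real.exp (-(z ^ 2 / (1 + z / r)))) z) atTop
      (nhds (∫ z : ℝ, z ^ k * Real.exp (-(z ^ 2)))) := by
    apply tendsto_integral_filter_of_dominated_convergence
      (fun z => (Real.exp 1 * (k.factorial + (k + 2).factorial)) * (1 + z ^ 2)⁻¹)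
    · filter_upwards with r
      apply AEStronglyMeasurable.indicator _ measurableSet_Ioc
      fun_prop
    · filter_upwards [eventually_ge_atTop 1] with r hr
      filter_upwards with z
      by_cases hz : z ∈ Set.Ioc (-r) (r ^ 3 / β - r)
      · rw [Set.indicator_of_mem hz]
        exact dom_bound k r z hr hz.1
      · rw [Set.indicator_of_notMem hz, norm_zero]
        positivity
    · exact integrable_inv_one_add_sq.const_mul _
    · filter_upwards with z
      have hlim : Tendsto (fun r : ℝ => z ^ k * Real.exp (-(z ^ 2 / (1 + z / r)))) atTop
          (nhds (z ^ k * Real.exp (-(z ^ 2)))) := by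
        have h0 : Tendsto (fun r : ℝ => z / r) atTop (nhds 0) := tendsto_const_nhds.div_atTop tendsto_id
        have h1 : Tendsto (fun r : ℝ => z ^ 2 / (1 + z / r)) atTop (nhds (z ^ 2 / (1 + 0))) :=
          tendsto_const_nhds.div (tendsto_const_nhds.add h0) (by norm_num)
        simp only [add_zero, div_one] at h1
        exact ((Real.continuous_exp.tendsto _).comp h1.neg).const_mul _
      refine hlim.congr' ?_
      filter_upwards [eventually_gt_atTop (-z), eventually_ge_atTop (β * (|z| + 1)),
        eventually_ge_atTop 1, eventually_ge_atTop (2 * β)] with r h1 h2 h3 h4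
      rw [Set.indicator_of_mem]
      refine ⟨by linarith, ?_⟩
      have : z + r ≤ r ^ 3 / β := by
        rw [le_div_iff₀ hβ]
        have := le_abs_self z
        have e1 : z * β ≤ r - β := by nlinarith
        nlinarith [mul_le_mul h3 h3 (by norm_num) (by linarith), mul_pos (by linarith : 0 < r) hβ,
          mul_nonneg (by linarith : 0 ≤ r) (by nlinarith : 0 ≤ r ^ 2 - r)]
      linarith
  refine key.congr' ?_
  filter_upwards [eventually_ge_atTop 0] with r hr
  have hle : -r ≤ r ^ 3 / β - r := by
    have : 0 ≤ r ^ 3 / β := by positivity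
    linarith
  rw [Jm, intervalIntegral.integral_of_le hle, integral_indicator measurableSet_Ioc]

lemma gauss0 : ∫ z : ℝ, z ^ 0 * Real.exp (-(z ^ 2)) = √Real.pi := by
  simpa using integral_gaussian 1

lemma gauss1 : ∫ z : ℝ, z ^ 1 * Real.exp (-(z ^ 2)) = 0 := by
  have h := integral_neg_eq_self (fun z : ℝ => z ^ 1 * Real.exp (-(z ^ 2))) volume
  simp only [pow_one, neg_mul, even_two, Even.neg_pow, integral_neg] at h ⊢
  linarith

lemma gauss2 : ∫ z : ℝ, z ^ 2 * Real.exp (-(z ^ 2)) = √Real.pi / 2 := by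
  have h := integral_rpow_mul_exp_neg_rpow (p := 2) (q := 2) (by norm_num) (by norm_num)
  have h3 : ∫ z : ℝ, z ^ 2 * Real.exp (-(z ^ 2)) = 2 * ∫ z in Set.Ioi (0:ℝ), z ^ 2 * Real.exp (-(z ^ 2)) := by
    have := integral_comp_abs (f := fun z : ℝ => z ^ 2 * Real.exp (-(z ^ 2)))
    simpa using this
  have h4 : Real.Gamma ((2 + 1) / 2) = √Real.pi / 2 := by
    have := Real.Gamma_add_one (s := 1 / 2) (by norm_num)
    rw [Real.Gamma_one_half_eq] at this
    rw [show ((2:ℝ) + 1) / 2 = 1 / 2 + 1 by norm_num, this]; ring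
  rw [h4] at h
  rw [h3]
  have h5 : ∫ z in Set.Ioi (0:ℝ), z ^ 2 * Real.exp (-(z ^ 2)) = 1 / 2 * (√Real.pi / 2) := by
    rw [← h]; simp
  rw [h5]; ring

lemma subst_int (β : ℝ) (hβ : 0 < β) (r : ℝ) (hr : 1 ≤ r) (j : ℕ) :
    ∫ x in (0:ℝ)..1, x ^ j * Real.exp (-(r ^ 4 / β * x) - β / x) =
      (β / r ^ 3 * Real.exp (-(2 * r ^ 2)) * (β / r ^ 2) ^ j) *
      ∫ z in (-r)..(r ^ 3 / β - r), (1 + z / r) ^ j * Real.exp (-(z ^ 2 / (1 + z / r))) := by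
  have hr0 : 0 < r := by linarith
  have h := intervalIntegral.mul_integral_comp_mul_add (a := -r) (b := r ^ 3 / β - r)
    (f := fun x => x ^ j * Real.exp (-(r ^ 4 / β * x) - β / x)) (β / r ^ 3) (β / r ^ 2)
  rw [show β / r ^ 3 * -r + β / r ^ 2 = 0 by field_simp; ring,
    show β / r ^ 3 * (r ^ 3 / β - r) + β / r ^ 2 = 1 by field_simp; ring] at h
  rw [← h, mul_assoc, mul_assoc]
  congr 1
  rw [← intervalIntegral.integral_const_mul, ← intervalIntegral.integral_const_mul]
  apply intervalIntegral.integral_congr_ae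
  filter_upwards with z hz
  have hle : -r ≤ r ^ 3 / β - r := by
    have : 0 ≤ r ^ 3 / β := by positivity
    linarith
  rw [Set.uIoc_of_le hle] at hz
  have hz1 : 0 < r + z := by linarith [hz.1]
  have e1 : β / r ^ 3 * z + β / r ^ 2 = β / r ^ 2 * (1 + z / r) := by field_simp; ring
  have hy : 1 + z / r = (r + z) / r := by field_simp
  have e2 : -(r ^ 4 / β * (β / r ^ 2 * (1 + z / r))) - β / (β / r ^ 2 * (1 + z / r)) =
      -(2 * r ^ 2) + -(z ^ 2 / (1 + z / r)) := by
    rw [hy]; field_simp; ring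
  rw [e1, e2, Real.exp_add, mul_pow]
  ring

lemma mv_formula (β : ℝ) (hβ : 0 < β) (r : ℝ) (hr : 1 ≤ r) :
    Jm β 0 r ≠ 0 ∧
    r ^ 2 * mpart β (r ^ 4 / β) = β * (1 + Jm β 1 r / Jm β 0 r * r⁻¹) ∧
    r ^ 6 * vpart β (r ^ 4 / β) = β ^ 2 * (Jm β 2 r / Jm β 0 r - (Jm β 1 r / Jm β 0 r) ^ 2) := by
  have hr0 : 0 < r := by linarith
  have i0 := Jm_intg β hβ 0 r hr
  have i1 := Jm_intg β hβ 1 r hr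
  have i2 := Jm_intg β hβ 2 r hr
  have s0 := subst_int β hβ r hr 0
  have s1 := subst_int β hβ r hr 1
  have s2 := subst_int β hβ r hr 2
  have t0 : ∫ z in (-r)..(r ^ 3 / β - r), (1 + z / r) ^ 0 * Real.exp (-(z ^ 2 / (1 + z / r))) = Jm β 0 r := by
    simp [Jm]
  have t1 : ∫ z in (-r)..(r ^ 3 / β - r), (1 + z / r) ^ 1 * Real.exp (-(z ^ 2 / (1 + z / r))) =
      Jm β 0 r + r⁻¹ * Jm β 1 r := by
    unfold Jm
    rw [← intervalIntegral.integral_const_mul, ← intervalIntegral.integral_add i0 (i1.const_mul _)]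
    congr 1; ext z; ring
  have t2 : ∫ z in (-r)..(r ^ 3 / β - r), (1 + z / r) ^ 2 * Real.exp (-(z ^ 2 / (1 + z / r))) =
      Jm β 0 r + 2 * r⁻¹ * Jm β 1 r + (r⁻¹) ^ 2 * Jm β 2 r := by
    unfold Jm
    rw [← intervalIntegral.integral_const_mul, ← intervalIntegral.integral_const_mul,
      ← intervalIntegral.integral_add i0 (i1.const_mul _),
      ← intervalIntegral.integral_add (i0.add (i1.const_mul _)) (i2.const_mul _)]
    congr 1; ext z; ring
  rw [t0] at s0; rw [t1] at s1; rw [t2] at s2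
  simp only [pow_zero, one_mul, mul_one, pow_one] at s0 s1
  have hc := cpart_pos β (r ^ 4 / β) hβ
  have hJ : Jm β 0 r ≠ 0 := by
    intro h
    unfold cpart at hc
    rw [s0, h, mul_zero] at hc
    exact lt_irrefl _ hc
  have hE := Real.exp_pos (-(2 * r ^ 2))
  have hm : mpart β (r ^ 4 / β) = β / r ^ 2 * (1 + Jm β 1 r / Jm β 0 r * r⁻¹) := by
    unfold mpart cpart
    rw [s0, s1]
    field_simp
  refine ⟨hJ, ?_, ?_⟩
  · rw [hm]; field_simp
  · unfold vpart
    rw [hm]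
    unfold cpart
    rw [s0, s2]
    field_simp
    ring

lemma asymp (β : ℝ) (hβ : 0 < β) :
    Tendsto (fun l : ℝ => √l ^ 1 * mpart β l) atTop (nhds √β) ∧
    Tendsto (fun l : ℝ => √l ^ 3 * vpart β l) atTop (nhds (√β / 2)) := by
  have J0 := Jm_tendsto β hβ 0
  have J1 := Jm_tendsto β hβ 1
  have J2 := Jm_tendsto β hβ 2
  rw [gauss0] at J0; rw [gauss1] at J1; rw [gauss2] at J2
  have hpi : √Real.pi ≠ 0 := (Real.sqrt_pos.2 Real.pi_pos).ne'
  have Q1 := J1.div J0 hpi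
  have Q2 := J2.div J0 hpi
  have A : Tendsto (fun r : ℝ => r ^ 2 * mpart β (r ^ 4 / β)) atTop (nhds β) := by
    have : Tendsto (fun r : ℝ => β * (1 + Jm β 1 r / Jm β 0 r * r⁻¹)) atTop
        (nhds (β * (1 + 0 / √Real.pi * 0))) :=
      ((Q1.mul tendsto_inv_atTop_zero).const_add 1).const_mul β
    simp only [mul_zero, add_zero, mul_one] at this
    refine this.congr' ?_
    filter_upwards [eventually_ge_atTop 1] with r hr
    exact (mv_formula β hβ r hr).2.1.symm
  have B : Tendsto (fun r : ℝ => r ^ 6 * vpart β (r ^ 4 / β)) atTop (nhds (β ^ 2 / 2)) := by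
    have : Tendsto (fun r : ℝ => β ^ 2 * (Jm β 2 r / Jm β 0 r - (Jm β 1 r / Jm β 0 r) ^ 2)) atTop
        (nhds (β ^ 2 * (√Real.pi / 2 / √Real.pi - (0 / √Real.pi) ^ 2))) :=
      (Q2.sub (Q1.pow 2)).const_mul _
    have e : β ^ 2 * (√Real.pi / 2 / √Real.pi - (0 / √Real.pi) ^ 2) = β ^ 2 / 2 := by
      field_simp; ring
    rw [e] at this
    refine this.congr' ?_
    filter_upwards [eventually_ge_atTop 1] with r hr
    exact (mv_formula β hβ r hr).2.2.symm
  have hr : Tendsto (fun l : ℝ => √√(β * l)) atTop atTop :=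
    Real.tendsto_sqrt_atTop.comp (Real.tendsto_sqrt_atTop.comp (tendsto_id.const_mul_atTop hβ))
  have hb : √β ≠ 0 := (Real.sqrt_pos.2 hβ).ne'
  have hbb : √β ^ 2 = β := Real.sq_sqrt hβ.le
  constructor
  · have := (A.comp hr).const_mul (√β)⁻¹
    have e : (√β)⁻¹ * β = √β := by field_simp; rw [hbb]
    rw [e] at this
    refine this.congr' ?_
    filter_upwards [eventually_ge_atTop 0] with l hl
    have e1 : √√(β * l) ^ 2 = √β * √l := by
      rw [Real.sq_sqrt (Real.sqrt_nonneg _), Real.sqrt_mul hβ.le]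
    have e2 : √√(β * l) ^ 4 / β = l := by
      rw [show (4:ℕ) = 2 * 2 by norm_num, pow_mul, e1, mul_pow, hbb, Real.sq_sqrt hl]; field_simp
    simp only [Function.comp]
    rw [e2, e1]; field_simp
  · have := (B.comp hr).const_mul ((√β)⁻¹ ^ 3)
    have e : (√β)⁻¹ ^ 3 * (β ^ 2 / 2) = √β / 2 := by
      nth_rewrite 2 [← hbb]; field_simp
    rw [e] at this
    refine this.congr' ?_
    filter_upwards [eventually_ge_atTop 0] with l hl
    have e1 : √√(β * l) ^ 2 = √β * √l := by
      rw [Real.sq_sqrt (Real.sqrt_nonneg _), Real.sqrt_mul hβ.le]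
    have e2 : √√(β * l) ^ 4 / β = l := by
      rw [show (4:ℕ) = 2 * 2 by norm_num, pow_mul, e1, mul_pow, hbb, Real.sq_sqrt hl]; field_simp
    simp only [Function.comp]
    rw [e2, show (6:ℕ) = 2 * 3 by norm_num, pow_mul, e1]; field_simp

lemma sum_as_int (G : ℕ → ℝ) (N : ℕ) :
    IntervalIntegrable (fun u : ℝ => G ⌈u⌉₊) volume 0 N ∧
    ∫ u in (0:ℝ)..N, G ⌈u⌉₊ = ∑ k ∈ Finset.Icc 1 N, G k := by
  have hpt : ∀ k : ℕ, ∀ u ∈ Set.uIoc (k:ℝ) ((k + 1 : ℕ) : ℝ), G (k + 1) = G ⌈u⌉₊ := by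
    intro k u hu
    rw [Set.uIoc_of_le (by push_cast; linarith)] at hu
    congr 1
    symm
    rw [Nat.ceil_eq_iff (by omega)]
    simpa using hu
  have hii : ∀ k : ℕ, IntervalIntegrable (fun u : ℝ => G ⌈u⌉₊) volume (k:ℝ) ((k + 1 : ℕ) : ℝ) := by
    intro k
    exact (intervalIntegrable_const (c := G (k + 1))).congr (hpt k)
  refine ⟨?_, ?_⟩
  · have := IntervalIntegrable.trans_iterate (a := fun k : ℕ => (k:ℝ)) (n := N)
      (fun k _ => hii k)
    simpa using this
  · have := intervalIntegral.sum_integral_adjacent_intervals (a := fun k : ℕ => (k:ℝ)) (n := N)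
      (fun k _ => hii k)
    simp only [Nat.cast_zero] at this
    have e : ∑ k ∈ Finset.Icc 1 N, G k = ∑ k ∈ Finset.range N, G (k + 1) := by
      clear this
      induction N with
      | zero => simp
      | succ n ih => rw [Finset.sum_Icc_succ_top (by omega), ih, Finset.sum_range_succ]
    rw [← this, e]
    apply Finset.sum_congr rfl
    intro k _
    have h2 : ∫ u in (k:ℝ)..((k + 1 : ℕ) : ℝ), G ⌈u⌉₊ = ∫ u in (k:ℝ)..((k + 1 : ℕ) : ℝ), G (k + 1) :=
      intervalIntegral.integral_congr_ae (Eventually.of_forall fun u hu => (hpt k u hu).symm)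
    rw [h2, intervalIntegral.integral_const]
    simp

lemma riemann (p : ℕ) (hp : 1 ≤ p) (f : ℝ → ℝ) (a : ℝ)
    (hf : Tendsto (fun l : ℝ => √l ^ p * f l) atTop (nhds a))
    (F : ℕ → ℝ) (hF0 : ∀ N, 0 ≤ F N) (F₀ : ℝ) (hF₀ : 0 ≤ F₀)
    (hF : Tendsto (fun N : ℕ => F N / N) atTop (nhds F₀))
    (L : ℕ → ℝ) (ν : ℝ) (hν : 0 < ν)
    (hL : Tendsto (fun N : ℕ => L N / (N:ℝ) ^ 2) atTop (nhds ν)) :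
    Tendsto (fun N : ℕ => (N:ℝ) ^ (p - 1) * ∑ k ∈ Finset.Icc 1 N, f (L N + (k:ℝ) * F N)) atTop
      (nhds (a * ∫ t in (0:ℝ)..1, (√(ν + F₀ * t))⁻¹ ^ p)) := by
  have hlow : ∀ᶠ N : ℕ in atTop, ∀ k : ℕ, (ν / 2) * (N:ℝ) ^ 2 ≤ L N + (k:ℝ) * F N := by
    filter_upwards [hL.eventually (lt_mem_nhds (half_lt_self hν)), eventually_gt_atTop 0] with N h1 h2 k
    have hN : (0:ℝ) < N := by exact_mod_cast h2
    rw [lt_div_iff₀ (by positivity)] at h1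
    have := mul_nonneg (Nat.cast_nonneg (α := ℝ) k) (hF0 N)
    linarith
  have hinf : Tendsto (fun N : ℕ => (ν / 2) * (N:ℝ) ^ 2) atTop atTop :=
    ((tendsto_pow_atTop two_ne_zero).comp tendsto_natCast_atTop_atTop).const_mul_atTop (by positivity)
  have key : Tendsto (fun N : ℕ => ∫ t in (0:ℝ)..1,
      (N:ℝ) ^ p * f (L N + ((⌈(N:ℝ) * t⌉₊ : ℕ) : ℝ) * F N)) atTop
      (nhds (∫ t in (0:ℝ)..1, a * (√(ν + F₀ * t))⁻¹ ^ p)) := by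
    apply intervalIntegral.tendsto_integral_filter_of_dominated_convergence
      (fun _ => (|a| + 1) * (√(ν / 2))⁻¹ ^ p)
    · filter_upwards with N
      have : Measurable (fun t : ℝ => (N:ℝ) ^ p * f (L N + ((⌈(N:ℝ) * t⌉₊ : ℕ) : ℝ) * F N)) := by
        have h1 : Measurable (fun k : ℕ => (N:ℝ) ^ p * f (L N + (k : ℝ) * F N)) :=
          measurable_from_top
        exact h1.comp (Nat.measurable_ceil.comp (measurable_const_mul _))
      exact this.aestronglyMeasurable
    · have hb : ∀ᶠ l in atTop, |√l ^ p * f l| ≤ |a| + 1 :=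
        hf.abs.eventually (Filter.Eventually.mono (gt_mem_nhds (by linarith : |a| < |a| + 1)) (fun _ h => h.le))
      obtain ⟨l0, hl0⟩ := eventually_atTop.1 hb
      filter_upwards [hlow, hinf.eventually_ge_atTop l0, eventually_gt_atTop 0] with N h1 h2 h3
      filter_upwards with t _
      have hN : (0:ℝ) < N := by exact_mod_cast h3
      set k := ⌈(N:ℝ) * t⌉₊
      have h4 := h1 k
      set l := L N + (k:ℝ) * F N
      have h5 := hl0 l (h2.trans h4)
      have h6 : √(ν / 2) * N ≤ √l := by
        apply Real.le_sqrt_of_sq_le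
        rw [mul_pow, Real.sq_sqrt (by positivity)]
        exact h4
      have hs : 0 < √(ν / 2) := Real.sqrt_pos.2 (by positivity)
      have h7 : (√(ν / 2) * N) ^ p * |f l| ≤ |a| + 1 := by
        rw [abs_mul, abs_of_nonneg (by positivity)] at h5
        refine le_trans ?_ h5
        gcongr
      rw [Real.norm_eq_abs, abs_mul, abs_of_nonneg (by positivity), inv_pow, ← div_eq_mul_inv,
        le_div_iff₀ (by positivity)]
      rw [mul_pow] at h7
      linarith
    · exact intervalIntegrable_const
    · filter_upwards with t ht
      rw [Set.uIoc_of_le zero_le_one] at ht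
      set l : ℕ → ℝ := fun N => L N + ((⌈(N:ℝ) * t⌉₊ : ℕ) : ℝ) * F N with hl
      have l1 : Tendsto l atTop atTop :=
        tendsto_atTop_mono' _ (hlow.mono fun N h => h _) hinf
      have l2 : Tendsto (fun N : ℕ => ((⌈(N:ℝ) * t⌉₊ : ℕ) : ℝ) / N) atTop (nhds t) := by
        have := (tendsto_nat_ceil_mul_div_atTop (R := ℝ) ht.1.le).comp tendsto_natCast_atTop_atTop
        refine this.congr fun N => ?_
        simp [mul_comm]
      have l3 : Tendsto (fun N : ℕ => l N / (N:ℝ) ^ 2) atTop (nhds (ν + F₀ * t)) := by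
        refine (hL.add (hF.mul l2)).congr' ?_
        filter_upwards [eventually_gt_atTop 0] with N h3
        have hN : (0:ℝ) < N := by exact_mod_cast h3
        simp only [hl]
        field_simp
      have hpos : 0 < ν + F₀ * t := by have := mul_nonneg hF₀ ht.1.le; linarith
      have l4 := ((Real.continuous_sqrt.tendsto _).comp l3).inv₀ (Real.sqrt_pos.2 hpos).ne'
      refine ((hf.comp l1).mul (l4.pow p)).congr' ?_
      filter_upwards [eventually_gt_atTop 0, l1.eventually_gt_atTop 0] with N h3 h4
      have hN : (0:ℝ) < N := by exact_mod_cast h3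
      have hs := Real.sqrt_pos.2 h4
      simp only [Function.comp]
      change _ = (N:ℝ) ^ p * f (l N)
      rw [Real.sqrt_div' _ (by positivity), Real.sqrt_sq hN.le, inv_div, div_pow]
      field_simp
  rw [intervalIntegral.integral_const_mul] at key
  refine key.congr' ?_
  filter_upwards [eventually_gt_atTop 0] with N h3
  have hN : (0:ℝ) < N := by exact_mod_cast h3
  have h := (sum_as_int (fun k => f (L N + (k:ℝ) * F N)) N).2
  have h' := intervalIntegral.integral_comp_mul_left (a := 0) (b := 1)
    (fun u : ℝ => f (L N + ((⌈u⌉₊ : ℕ) : ℝ) * F N)) hN.ne'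
  rw [mul_zero, mul_one, h, smul_eq_mul] at h'
  rw [intervalIntegral.integral_const_mul, h']
  obtain ⟨q, rfl⟩ := Nat.exists_eq_add_of_le' hp
  rw [Nat.add_sub_cancel, pow_succ, mul_assoc, mul_inv_cancel_left₀ hN.ne']

lemma I1 (F₀ ν : ℝ) (hF₀ : 0 ≤ F₀) (hν : 0 < ν) :
    ∫ t in (0:ℝ)..1, (√(ν + F₀ * t))⁻¹ ^ 1 = 2 / (√(ν + F₀) + √ν) := by
  have hs := Real.sqrt_pos.2 hν
  rcases hF₀.eq_or_lt with h | h
  · subst h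
    simp only [zero_mul, add_zero, pow_one, intervalIntegral.integral_const]
    simp only [sub_zero, smul_eq_mul, one_mul]
    rw [← two_mul, div_mul_eq_div_div, div_self two_ne_zero, one_div]
  · have hd : ∀ t ∈ Set.uIcc (0:ℝ) 1, HasDerivAt (fun t => 2 * √(ν + F₀ * t) / F₀)
        ((√(ν + F₀ * t))⁻¹ ^ 1) t := by
      intro t ht
      rw [Set.uIcc_of_le zero_le_one] at ht
      have hp : 0 < ν + F₀ * t := by have := mul_nonneg hF₀ ht.1; linarith
      have h1 : HasDerivAt (fun t => ν + F₀ * t) F₀ t := by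
        simpa using ((hasDerivAt_id t).const_mul F₀).const_add ν
      have := ((h1.sqrt hp.ne').const_mul 2).div_const F₀
      have hq := Real.sqrt_pos.2 hp
      have e : (√(ν + F₀ * t))⁻¹ ^ 1 = 2 * (F₀ / (2 * √(ν + F₀ * t))) / F₀ := by field_simp
      rw [e]
      exact this
    rw [intervalIntegral.integral_eq_sub_of_hasDerivAt hd]
    · simp only [mul_one, mul_zero, add_zero]
      have h1 := Real.sq_sqrt hν.le
      have h2 := Real.sq_sqrt (by linarith : 0 ≤ ν + F₀)
      have h3 := Real.sqrt_nonneg (ν + F₀)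
      field_simp
      nlinarith
    · apply ContinuousOn.intervalIntegrable
      intro t ht
      rw [Set.uIcc_of_le zero_le_one] at ht
      have hp : 0 < ν + F₀ * t := by have := mul_nonneg hF₀ ht.1; linarith
      have hc : ContinuousAt (fun t => √(ν + F₀ * t)) t := by fun_prop
      exact ((hc.inv₀ (Real.sqrt_pos.2 hp).ne').pow 1).continuousWithinAt

lemma I3 (F₀ ν : ℝ) (hF₀ : 0 ≤ F₀) (hν : 0 < ν) :
    0 < ∫ t in (0:ℝ)..1, (√(ν + F₀ * t))⁻¹ ^ 3 := by
  have hp : ∀ t ∈ Set.Icc (0:ℝ) 1, 0 < ν + F₀ * t := by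
    intro t ht; have := mul_nonneg hF₀ ht.1; linarith
  apply intervalIntegral.intervalIntegral_pos_of_pos_on _ _ zero_lt_one
  · apply ContinuousOn.intervalIntegrable
    intro t ht
    rw [Set.uIcc_of_le zero_le_one] at ht
    have hc : ContinuousAt (fun t => √(ν + F₀ * t)) t := by fun_prop
    exact ((hc.inv₀ (Real.sqrt_pos.2 (hp t ht)).ne').pow 3).continuousWithinAt
  · intro t ht
    have := Real.sqrt_pos.2 (hp t ⟨ht.1.le, ht.2.le⟩)
    positivity

/-- Subcritical limit. -/
theorem sigma_asymptotic_subcritical (β F₀ : ℝ) (hβ : 0 < β)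
    (hF₀0 : 0 ≤ F₀) (hF₀ : F₀ < 4 * β)
    (F : ℕ → ℝ) (hF0 : ∀ N, 0 ≤ F N)
    (hF : Tendsto (fun N : ℕ => F N / N) atTop (nhds F₀))
    (lam : ℕ → ℝ)
    (hlam : ∀ N : ℕ, 2 ≤ N →
      ∑ k ∈ Finset.Icc 1 N, mpart β (lam N + (k : ℝ) * F N) = 1) :
    (∃ C > (0:ℝ), Tendsto
        (fun N : ℕ => (N : ℝ) ^ 2 * ∑ k ∈ Finset.Icc 1 N, vpart β (lam N + (k : ℝ) * F N))
        atTop (nhds C)) ∧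
    ∃ C' > (0:ℝ), ∃ N₀ : ℕ, ∀ N ≥ N₀, ∀ k : ℕ, 1 ≤ k → k ≤ N →
      vpart β (lam N + (k : ℝ) * F N) ≤ C' / (N : ℝ) ^ 3 := by
  obtain ⟨hm, hv⟩ := asymp β hβ
  have hb : 0 < √β := Real.sqrt_pos.2 hβ
  have hbb : √β ^ 2 = β := Real.sq_sqrt hβ.le
  obtain ⟨μ, hμ, hμeq⟩ : ∃ μ : ℝ, 0 < μ ∧ √(μ + F₀) + √μ = 2 * √β := by
    have hp : 0 < (4 * β - F₀) / (4 * √β) := div_pos (by linarith) (by positivity)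
    have hq : 0 < (4 * β + F₀) / (4 * √β) := div_pos (by linarith) (by positivity)
    refine ⟨((4 * β - F₀) / (4 * √β)) ^ 2, by positivity, ?_⟩
    have e : ((4 * β - F₀) / (4 * √β)) ^ 2 + F₀ = ((4 * β + F₀) / (4 * √β)) ^ 2 := by
      rw [div_pow, div_pow, mul_pow, hbb]; field_simp; ring
    rw [e, Real.sqrt_sq hq.le, Real.sqrt_sq hp.le]
    field_simp
    rw [hbb]; ring
  have hsum : ∀ ν : ℝ, 0 < ν → Tendsto (fun N : ℕ => ∑ k ∈ Finset.Icc 1 N,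
      mpart β (ν * (N:ℝ) ^ 2 + (k:ℝ) * F N)) atTop (nhds (√β * (2 / (√(ν + F₀) + √ν)))) := by
    intro ν hν
    have hL : Tendsto (fun N : ℕ => ν * (N:ℝ) ^ 2 / (N:ℝ) ^ 2) atTop (nhds ν) := by
      refine tendsto_const_nhds.congr' ?_
      filter_upwards [eventually_gt_atTop 0] with N h3
      have hN : (0:ℝ) < N := by exact_mod_cast h3
      field_simp
    have := riemann 1 le_rfl (mpart β) (√β) hm F hF0 F₀ hF₀0 hF (fun N => ν * (N:ℝ) ^ 2) ν hν hL
    rw [I1 F₀ ν hF₀0 hν] at this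
    simpa using this
  have hmono := mpart_antitone β hβ
  have hlim : Tendsto (fun N : ℕ => lam N / (N:ℝ) ^ 2) atTop (nhds μ) := by
    rw [tendsto_order]
    constructor
    · intro a ha
      set ν := max a (μ / 2) with hν
      have hν0 : 0 < ν := lt_of_lt_of_le (by positivity) (le_max_right _ _)
      have hνμ : ν < μ := max_lt ha (by linarith)
      have h1 : 1 < √β * (2 / (√(ν + F₀) + √ν)) := by
        have e1 : √ν < √μ := Real.sqrt_lt_sqrt hν0.le hνμ
        have e2 : √(ν + F₀) ≤ √(μ + F₀) := Real.sqrt_le_sqrt (by linarith)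
        have e3 := Real.sqrt_pos.2 hν0
        have e4 := Real.sqrt_nonneg (ν + F₀)
        rw [← mul_div_assoc, lt_div_iff₀ (by positivity)]
        linarith
      filter_upwards [(hsum ν hν0).eventually (lt_mem_nhds h1), eventually_ge_atTop 2] with N h2 h3
      have hN : (0:ℝ) < N := by exact_mod_cast (by omega : 0 < N)
      by_contra! hcon
      rw [div_le_iff₀ (by positivity)] at hcon
      have h4 : lam N ≤ ν * (N:ℝ) ^ 2 :=
        hcon.trans (mul_le_mul_of_nonneg_right (le_max_left _ _) (by positivity))
      have h5 : ∑ k ∈ Finset.Icc 1 N, mpart β (ν * (N:ℝ) ^ 2 + (k:ℝ) * F N) ≤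
          ∑ k ∈ Finset.Icc 1 N, mpart β (lam N + (k:ℝ) * F N) :=
        Finset.sum_le_sum fun k _ => hmono (by linarith)
      rw [hlam N h3] at h5
      linarith
    · intro ν hνμ
      have hν0 : 0 < ν := by linarith
      have h1 : √β * (2 / (√(ν + F₀) + √ν)) < 1 := by
        have e1 : √μ < √ν := Real.sqrt_lt_sqrt hμ.le hνμ
        have e2 : √(μ + F₀) ≤ √(ν + F₀) := Real.sqrt_le_sqrt (by linarith)
        have e3 := Real.sqrt_pos.2 hν0
        have e4 := Real.sqrt_nonneg (ν + F₀)
        rw [← mul_div_assoc, div_lt_iff₀ (by positivity)]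
        linarith
      filter_upwards [(hsum ν hν0).eventually (gt_mem_nhds h1), eventually_ge_atTop 2] with N h2 h3
      have hN : (0:ℝ) < N := by exact_mod_cast (by omega : 0 < N)
      by_contra! hcon
      rw [le_div_iff₀ (by positivity)] at hcon
      have h5 : ∑ k ∈ Finset.Icc 1 N, mpart β (lam N + (k:ℝ) * F N) ≤
          ∑ k ∈ Finset.Icc 1 N, mpart β (ν * (N:ℝ) ^ 2 + (k:ℝ) * F N) :=
        Finset.sum_le_sum fun k _ => hmono (by linarith)
      rw [hlam N h3] at h5
      linarith
  constructor
  · refine ⟨_, ?_, riemann 3 (by norm_num) (vpart β) (√β / 2) hv F hF0 F₀ hF₀0 hF lam μ hμ hlim⟩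
    exact mul_pos (by positivity) (I3 F₀ μ hF₀0 hμ)
  · have hs : 0 < √(μ / 2) := Real.sqrt_pos.2 (by positivity)
    refine ⟨(√β / 2 + 1) / √(μ / 2) ^ 3, by positivity, ?_⟩
    have hev : ∀ᶠ l in atTop, √l ^ 3 * vpart β l < √β / 2 + 1 :=
      hv.eventually (gt_mem_nhds (by linarith))
    obtain ⟨l0, hl0⟩ := eventually_atTop.1 hev
    have hinf : Tendsto (fun N : ℕ => (μ / 2) * (N:ℝ) ^ 2) atTop atTop :=
      ((tendsto_pow_atTop two_ne_zero).comp tendsto_natCast_atTop_atTop).const_mul_atTop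
        (by positivity)
    apply eventually_atTop.1
    filter_upwards [hlim.eventually (lt_mem_nhds (half_lt_self hμ)),
      hinf.eventually_ge_atTop l0, eventually_gt_atTop 0] with N h1 h2 h3 k _ _
    have hN : (0:ℝ) < N := by exact_mod_cast h3
    rw [lt_div_iff₀ (by positivity)] at h1
    have hk := mul_nonneg (Nat.cast_nonneg (α := ℝ) k) (hF0 N)
    set l := lam N + (k:ℝ) * F N
    have h4 : μ / 2 * (N:ℝ) ^ 2 ≤ l := by simp only [l]; linarith
    have h5 := hl0 l (h2.trans h4)
    have h6 : √(μ / 2) * N ≤ √l := by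
      apply Real.le_sqrt_of_sq_le
      rw [mul_pow, Real.sq_sqrt (by positivity)]
      exact h4
    rcases le_total (vpart β l) 0 with h7 | h7
    · exact h7.trans (by positivity)
    · rw [div_div, le_div_iff₀ (by positivity), ← mul_pow, mul_comm]
      refine le_trans ?_ h5.le
      gcongr
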